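/- Let F be a field and let γ₁ ∈ Sp_8(F) be the matrix with entry (1,8) equal to −1, entries (k,k) equal to 1 for 2 ≤ k ≤ 7, entry (8,1) equal to 1, and all other entries 0. Then { p ∈ P_{2,8}(F) : γ₁·p·γ₁^{−1} ∈ P_8(F) } = { diag(g₀, h₀, J_2 ᵗg₀^{−1} J_2) · v(x,y,z) : g₀ ∈ GL_2(F) lower triangular, h₀ ∈ P_4(F), v(x,y,z) ∈ N_{2,8}(F) with the first row of x equal to zero and the (1,2) entry of z equal to zero }. -/

import Mathlib

open Matrix

namespace GS

noncomputable section

/-- `Jmat F n` : the `n × n` matrix over `F` with ones on the antidiagonal, zeros elsewhere. -/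
def Jmat (F : Type*) [Field F] (n : ℕ) : Matrix (Fin n) (Fin n) F :=
  Matrix.of fun i j => if (i : ℕ) + (j : ℕ) = n - 1 then (1 : F) else 0

/-- The symplectic form matrix `((0, J_n), (-J_n, 0))` in `n × n` block form. -/
def OmegaMat (F : Type*) [Field F] (n : ℕ) : Matrix (Fin (n + n)) (Fin (n + n)) F :=
  Matrix.reindex finSumFinEquiv finSumFinEquiv
    (Matrix.fromBlocks 0 (Jmat F n) (-(Jmat F n)) 0)

/-- `Sp_{2n}(F) = { g : ᵗg Ω g = Ω }`. -/
def SpSet (F : Type*) [Field F] (n : ℕ) : Set (Matrix (Fin (n + n)) (Fin (n + n)) F) :=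
  {g | gᵀ * OmegaMat F n * g = OmegaMat F n}

/-- `Sp_4(F)`. -/
def Sp4 (F : Type*) [Field F] : Set (Matrix (Fin 4) (Fin 4) F) := SpSet F 2

/-- `Sp_8(F)`. -/
def Sp8 (F : Type*) [Field F] : Set (Matrix (Fin 8) (Fin 8) F) := SpSet F 4

/-- `Sp_16(F)`. -/
def Sp16 (F : Type*) [Field F] : Set (Matrix (Fin 16) (Fin 16) F) := SpSet F 8

/-- `Mat_2^0(F) = { A : ᵗA J₂ = J₂ A }`. -/
def Mat20 (F : Type*) [Field F] : Set (Matrix (Fin 2) (Fin 2) F) :=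
  {A | Aᵀ * Jmat F 2 = Jmat F 2 * A}

/-- `y* = J₂ ᵗy J₂`. -/
def starJ (F : Type*) [Field F] (y : Matrix (Fin 2) (Fin 2) F) : Matrix (Fin 2) (Fin 2) F :=
  Jmat F 2 * yᵀ * Jmat F 2

/-- Assemble an `8 × 8` matrix from sixteen `2 × 2` blocks. -/
def blk8 (F : Type*) [Field F] (B : Fin 4 → Fin 4 → Matrix (Fin 2) (Fin 2) F) :
    Matrix (Fin 8) (Fin 8) F :=
  Matrix.of fun i j =>
    B ⟨(i : ℕ) / 2, by have := i.isLt; omega⟩ ⟨(j : ℕ) / 2, by have := j.isLt; omega⟩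
      ⟨(i : ℕ) % 2, by omega⟩ ⟨(j : ℕ) % 2, by omega⟩

/-- The matrix `v(x, y, z)`: identity except block `(1,2) = x`, `(1,3) = y`,
`(1,4) = z`, `(2,4) = y* = J₂ ᵗy J₂`, `(3,4) = x* = -J₂ ᵗx J₂`. -/
def vMat (F : Type*) [Field F] (x y z : Matrix (Fin 2) (Fin 2) F) :
    Matrix (Fin 8) (Fin 8) F :=
  blk8 F fun bi bj =>
    if bi = bj then (1 : Matrix (Fin 2) (Fin 2) F)
    else if bi = 0 ∧ bj = 1 then x
    else if bi = 0 ∧ bj = 2 then y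
    else if bi = 0 ∧ bj = 3 then z
    else if bi = 1 ∧ bj = 3 then starJ F y
    else if bi = 2 ∧ bj = 3 then -(starJ F x)
    else 0

/-- `N_{2,8}(F)`. -/
def N28 (F : Type*) [Field F] : Set (Matrix (Fin 8) (Fin 8) F) :=
  {M | ∃ x y z : Matrix (Fin 2) (Fin 2) F,
    z - x * starJ F y ∈ Mat20 F ∧ M = vMat F x y z}

/-- The center subgroup `N_{2,8}^c(F) = { v(0,0,z) : z ∈ Mat_2^0(F) }`. -/
def N28c (F : Type*) [Field F] : Set (Matrix (Fin 8) (Fin 8) F) :=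
  {M | ∃ z ∈ Mat20 F, M = vMat F 0 0 z}

/-- The underlying set of the Heisenberg group `H_9(F)`. -/
abbrev H9 (F : Type*) [Field F] :=
  Matrix (Fin 2) (Fin 2) F × Matrix (Fin 2) (Fin 2) F × F

/-- The Heisenberg multiplication on `H_9(F)` attached to `T`. -/
def H9mul (F : Type*) [Field F] (T : Matrix (Fin 2) (Fin 2) F) (a b : H9 F) : H9 F :=
  (a.1 + b.1, a.2.1 + b.2.1,
    a.2.2 + b.2.2 +
      (T * (a.1 * (Jmat F 2 * b.2.1ᵀ * Jmat F 2) -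
            a.2.1 * (Jmat F 2 * b.1ᵀ * Jmat F 2))).trace)

/-- The `8 × 8` block diagonal matrix `diag(m, h, m')` with blocks of sizes `2, 4, 2`. -/
def diag242 (F : Type*) [Field F] (m : Matrix (Fin 2) (Fin 2) F)
    (h : Matrix (Fin 4) (Fin 4) F) (m' : Matrix (Fin 2) (Fin 2) F) :
    Matrix (Fin 8) (Fin 8) F :=
  Matrix.of fun i j =>
    if hi : (i : ℕ) < 2 then
      if hj : (j : ℕ) < 2 then m ⟨(i : ℕ), hi⟩ ⟨(j : ℕ), hj⟩ else 0
    else if hi2 : (i : ℕ) < 6 then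
      if hj2 : 2 ≤ (j : ℕ) ∧ (j : ℕ) < 6 then
        h ⟨(i : ℕ) - 2, by omega⟩ ⟨(j : ℕ) - 2, by omega⟩
      else 0
    else
      if hj3 : 6 ≤ (j : ℕ) then
        m' ⟨(i : ℕ) - 6, by have := i.isLt; omega⟩ ⟨(j : ℕ) - 6, by have := j.isLt; omega⟩
      else 0

/-- The segment (`{1,2}`, `{3,4,5,6}` or `{7,8}`) of an index in `Fin 8`. -/
def seg8 (i : Fin 8) : ℕ := if (i : ℕ) < 2 then 0 else if (i : ℕ) < 6 then 1 else 2

/-- `w = ((0, I₂), (I₂, 0))`. -/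
def wMat (F : Type*) [Field F] : Matrix (Fin 4) (Fin 4) F :=
  Matrix.reindex finSumFinEquiv finSumFinEquiv
    (Matrix.fromBlocks (0 : Matrix (Fin 2) (Fin 2) F) (1 : Matrix (Fin 2) (Fin 2) F)
      (1 : Matrix (Fin 2) (Fin 2) F) (0 : Matrix (Fin 2) (Fin 2) F))

/-- The embedding `t : Sp₄ × Sp₄ → Mat₁₆`, with respect to the partition of `{1,…,16}`
into `I₁ = {1,…,4}`, `I₂ = {5,6}`, `I₃ = {7,…,10}`, `I₄ = {11,12}`, `I₅ = {13,…,16}`: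
block `(I₁,I₁) = g₁`, `(I₃,I₃) = g₂`, `(I₅,I₅) = J₄ ᵗg₁⁻¹ J₄`, `(I₂,I₂) = g_{1,1}`,
`(I₂,I₄) = g_{1,2}`, `(I₄,I₂) = g_{1,3}`, `(I₄,I₄) = g_{1,4}`, all other blocks zero. -/
def tEmb (F : Type*) [Field F] (g₁ g₂ : Matrix (Fin 4) (Fin 4) F) :
    Matrix (Fin 16) (Fin 16) F :=
  Matrix.of fun i j =>
    if hi1 : (i : ℕ) < 4 then
      if hj1 : (j : ℕ) < 4 then g₁ ⟨(i : ℕ), hi1⟩ ⟨(j : ℕ), hj1⟩ else 0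
    else if hi2 : (i : ℕ) < 6 then
      if hj2 : 4 ≤ (j : ℕ) ∧ (j : ℕ) < 6 then
        g₁ ⟨(i : ℕ) - 4, by omega⟩ ⟨(j : ℕ) - 4, by omega⟩
      else if hj4 : 10 ≤ (j : ℕ) ∧ (j : ℕ) < 12 then
        g₁ ⟨(i : ℕ) - 4, by omega⟩ ⟨(j : ℕ) - 10 + 2, by omega⟩
      else 0
    else if hi3 : (i : ℕ) < 10 then
      if hj3 : 6 ≤ (j : ℕ) ∧ (j : ℕ) < 10 then
        g₂ ⟨(i : ℕ) - 6, by omega⟩ ⟨(j : ℕ) - 6, by omega⟩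
      else 0
    else if hi4 : (i : ℕ) < 12 then
      if hj2 : 4 ≤ (j : ℕ) ∧ (j : ℕ) < 6 then
        g₁ ⟨(i : ℕ) - 10 + 2, by omega⟩ ⟨(j : ℕ) - 4, by omega⟩
      else if hj4 : 10 ≤ (j : ℕ) ∧ (j : ℕ) < 12 then
        g₁ ⟨(i : ℕ) - 10 + 2, by omega⟩ ⟨(j : ℕ) - 10 + 2, by omega⟩
      else 0
    else
      if hj5 : 12 ≤ (j : ℕ) then
        (Jmat F 4 * (g₁⁻¹)ᵀ * Jmat F 4) ⟨(i : ℕ) - 12, by have := i.isLt; omega⟩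
          ⟨(j : ℕ) - 12, by have := j.isLt; omega⟩
      else 0

/-- `γ₁`: entry `(1,8) = -1`, entries `(k,k) = 1` for `2 ≤ k ≤ 7`, entry `(8,1) = 1`
(1-indexed), all other entries `0`. -/
def gamma1 (F : Type*) [Field F] : Matrix (Fin 8) (Fin 8) F :=
  Matrix.of fun i j =>
    if (i : ℕ) = 0 ∧ (j : ℕ) = 7 then -1
    else if (i : ℕ) = 7 ∧ (j : ℕ) = 0 then 1
    else if i = j ∧ 1 ≤ (i : ℕ) ∧ (i : ℕ) ≤ 6 then 1
    else 0

/-- `γ₂`: block (rows 1–2, columns 7–8) `= -I₂`, block (rows 3–6, columns 3–6) `= I₄`,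
block (rows 7–8, columns 1–2) `= I₂` (1-indexed), all other entries `0`. -/
def gamma2 (F : Type*) [Field F] : Matrix (Fin 8) (Fin 8) F :=
  Matrix.of fun i j =>
    if (i : ℕ) < 2 ∧ (j : ℕ) = (i : ℕ) + 6 then -1
    else if 2 ≤ (i : ℕ) ∧ (i : ℕ) < 6 ∧ i = j then 1
    else if 6 ≤ (i : ℕ) ∧ (j : ℕ) + 6 = (i : ℕ) then 1
    else 0

/-- The Siegel parabolic `P_8(F)` of `Sp_8(F)`: lower-left `4 × 4` block zero. -/
def P8 (F : Type*) [Field F] : Set (Matrix (Fin 8) (Fin 8) F) :=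
  {g | g ∈ Sp8 F ∧ ∀ i j : Fin 8, 4 ≤ (i : ℕ) → (j : ℕ) < 4 → g i j = 0}

/-- The Siegel parabolic `P_4(F)` of `Sp_4(F)`: lower-left `2 × 2` block zero. -/
def P4 (F : Type*) [Field F] : Set (Matrix (Fin 4) (Fin 4) F) :=
  {h | h ∈ Sp4 F ∧ ∀ i j : Fin 4, 2 ≤ (i : ℕ) → (j : ℕ) < 2 → h i j = 0}

/-- The span of the first two standard basis vectors `e₁, e₂` of `F^8`. -/
def E2 (F : Type*) [Field F] : Submodule F (Fin 8 → F) :=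
  Submodule.span F {Pi.single (0 : Fin 8) (1 : F), Pi.single (1 : Fin 8) (1 : F)}

/-- `P_{2,8}(F)`: elements of `Sp_8(F)` mapping the span of `e₁, e₂` onto itself. -/
def P28 (F : Type*) [Field F] : Set (Matrix (Fin 8) (Fin 8) F) :=
  {g | g ∈ Sp8 F ∧ Submodule.map g.mulVecLin (E2 F) = E2 F}

/-- The double coset `P_8(F) · γ · P_{2,8}(F)`. -/
def dcoset (F : Type*) [Field F] (γ : Matrix (Fin 8) (Fin 8) F) :
    Set (Matrix (Fin 8) (Fin 8) F) :=
  {g | ∃ p ∈ P8 F, ∃ q ∈ P28 F, g = p * γ * q}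

/-- The orbit of `ξ` under the right multiplication action of `GL₂(F)` on `Mat₂(F)`. -/
def rOrbit (F : Type*) [Field F] (ξ : Matrix (Fin 2) (Fin 2) F) :
    Set (Matrix (Fin 2) (Fin 2) F) :=
  {A | ∃ g, IsUnit g ∧ A = ξ * g}

theorem Jmat_two (F : Type*) [Field F] : Jmat F 2 = !![0, 1; 1, 0] := by
  ext i j
  fin_cases i <;> fin_cases j <;> rfl

theorem OmegaMat_apply (F : Type*) [Field F] {n : ℕ} (i j : Fin (n + n)) :
    OmegaMat F n i j =
      if (i : ℕ) + j = n + n - 1 then (if (i : ℕ) < n then 1 else -1) else 0 := by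
  obtain ⟨a, rfl⟩ := finSumFinEquiv.surjective i
  obtain ⟨b, rfl⟩ := finSumFinEquiv.surjective j
  simp only [OmegaMat, Matrix.reindex_apply, Matrix.submatrix_apply, Equiv.symm_apply_apply]
  rcases a with a | a <;> rcases b with b | b <;>
    have ha := a.isLt <;> have hb := b.isLt <;>
    simp only [Matrix.fromBlocks_apply₁₁, Matrix.fromBlocks_apply₁₂, Matrix.fromBlocks_apply₂₁,
      Matrix.fromBlocks_apply₂₂, finSumFinEquiv_apply_left, finSumFinEquiv_apply_right,
      Fin.val_castAdd, Fin.val_natAdd, Matrix.zero_apply, Matrix.neg_apply, Jmat,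
      Matrix.of_apply] <;>
    grind

theorem OmegaMat_mul_self (F : Type*) [Field F] (n : ℕ) :
    OmegaMat F n * OmegaMat F n = -1 := by
  have hJ : Jmat F n * Jmat F n = 1 := by
    ext i k
    have hi := i.isLt
    rw [Matrix.mul_apply, Finset.sum_eq_single (Fin.rev i)]
    · simp only [Jmat, Matrix.of_apply, Matrix.one_apply, Fin.ext_iff, Fin.val_rev]
      have hk := k.isLt
      grind
    · intro j _ hj
      have hj' : (j : ℕ) ≠ n - (i + 1) := fun h => hj (Fin.ext (by simpa using h))
      simp only [Jmat, Matrix.of_apply]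
      rw [if_neg (by omega), zero_mul]
    · simp
  rw [OmegaMat, Matrix.reindex_apply, Matrix.submatrix_mul_equiv, Matrix.fromBlocks_multiply]
  have h : (Matrix.fromBlocks (-1) 0 0 (-1) : Matrix (Fin n ⊕ Fin n) (Fin n ⊕ Fin n) F) = -1 := by
    rw [← Matrix.fromBlocks_one, Matrix.fromBlocks_neg, neg_zero]
  simp [hJ, h, Matrix.submatrix_neg]

theorem isUnit_det_of_mem_SpSet {F : Type*} [Field F] {n : ℕ}
    {g : Matrix (Fin (n + n)) (Fin (n + n)) F} (hg : g ∈ SpSet F n) : IsUnit g.det := by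
  have h : (-(OmegaMat F n * gᵀ * OmegaMat F n)) * g = 1 := by
    have hg' : gᵀ * OmegaMat F n * g = OmegaMat F n := hg
    rw [neg_mul, mul_assoc, mul_assoc, ← mul_assoc gᵀ, hg', OmegaMat_mul_self, neg_neg]
  exact (Matrix.isUnit_iff_isUnit_det _).mp (IsUnit.of_mul_eq_one_right _ h)

theorem mul_mem_SpSet {F : Type*} [Field F] {n : ℕ}
    {g h : Matrix (Fin (n + n)) (Fin (n + n)) F} (hg : g ∈ SpSet F n) (hh : h ∈ SpSet F n) :
    g * h ∈ SpSet F n := by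
  have hg' : gᵀ * OmegaMat F n * g = OmegaMat F n := hg
  have hh' : hᵀ * OmegaMat F n * h = OmegaMat F n := hh
  change (g * h)ᵀ * OmegaMat F n * (g * h) = OmegaMat F n
  calc _ = hᵀ * (gᵀ * OmegaMat F n * g) * h := by simp only [Matrix.transpose_mul, mul_assoc]
    _ = _ := by rw [hg', hh']

theorem inv_mem_SpSet {F : Type*} [Field F] {n : ℕ}
    {g : Matrix (Fin (n + n)) (Fin (n + n)) F} (hg : g ∈ SpSet F n) :
    g⁻¹ ∈ SpSet F n := by
  have hu := isUnit_det_of_mem_SpSet hg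
  have hg' : gᵀ * OmegaMat F n * g = OmegaMat F n := hg
  change (g⁻¹)ᵀ * OmegaMat F n * g⁻¹ = OmegaMat F n
  calc _ = (g⁻¹)ᵀ * (gᵀ * OmegaMat F n * g) * g⁻¹ := by rw [hg']
    _ = (g * g⁻¹)ᵀ * OmegaMat F n * (g * g⁻¹) := by
      simp only [Matrix.transpose_mul, mul_assoc]
    _ = _ := by simp [Matrix.mul_nonsing_inv _ hu]

theorem mem_Sp4_iff {F : Type*} [Field F] (g : Matrix (Fin 4) (Fin 4) F) :
    g ∈ Sp4 F ↔ ∀ i j : Fin 4,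
      g 0 i * g 3 j + g 1 i * g 2 j - g 2 i * g 1 j - g 3 i * g 0 j =
      if (i : ℕ) + j = 3 then (if (i : ℕ) < 2 then 1 else -1) else 0 := by
  have hΩ : OmegaMat F 2 =
      !![0, 0, 0, 1;
         0, 0, 1, 0;
         0, -1, 0, 0;
         -1, 0, 0, 0] := by
    ext i j
    fin_cases i <;> fin_cases j <;> first | rfl | exact neg_zero
  change gᵀ * OmegaMat F 2 * g = OmegaMat F 2 ↔ _
  rw [← Matrix.ext_iff]
  refine forall_congr' fun i => forall_congr' fun j => ?_
  rw [OmegaMat_apply, hΩ, mul_assoc, Matrix.mul_apply, Fin.sum_univ_four]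
  refine iff_of_eq (congrArg (· = _) ?_)
  simp [Matrix.mul_apply, Fin.sum_univ_four]
  ring

theorem mem_Sp8_iff {F : Type*} [Field F] (g : Matrix (Fin 8) (Fin 8) F) :
    g ∈ Sp8 F ↔ ∀ i j : Fin 8,
      g 0 i * g 7 j + g 1 i * g 6 j + g 2 i * g 5 j + g 3 i * g 4 j
        - g 4 i * g 3 j - g 5 i * g 2 j - g 6 i * g 1 j - g 7 i * g 0 j =
      if (i : ℕ) + j = 7 then (if (i : ℕ) < 4 then 1 else -1) else 0 := by
  have hΩ : OmegaMat F 4 =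
      !![0, 0, 0, 0, 0, 0, 0, 1;
         0, 0, 0, 0, 0, 0, 1, 0;
         0, 0, 0, 0, 0, 1, 0, 0;
         0, 0, 0, 0, 1, 0, 0, 0;
         0, 0, 0, -1, 0, 0, 0, 0;
         0, 0, -1, 0, 0, 0, 0, 0;
         0, -1, 0, 0, 0, 0, 0, 0;
         -1, 0, 0, 0, 0, 0, 0, 0] := by
    ext i j
    fin_cases i <;> fin_cases j <;> first | rfl | exact neg_zero
  change gᵀ * OmegaMat F 4 * g = OmegaMat F 4 ↔ _
  rw [← Matrix.ext_iff]
  refine forall_congr' fun i => forall_congr' fun j => ?_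
  rw [OmegaMat_apply, hΩ, mul_assoc, Matrix.mul_apply, Fin.sum_univ_eight]
  refine iff_of_eq (congrArg (· = _) ?_)
  simp [Matrix.mul_apply, Fin.sum_univ_eight]
  ring

theorem starJ_eq {F : Type*} [Field F] (y : Matrix (Fin 2) (Fin 2) F) :
    starJ F y = !![y 1 1, y 0 1; y 1 0, y 0 0] := by
  ext i j
  rw [starJ, Jmat_two, mul_assoc]
  fin_cases i <;> fin_cases j <;> simp [Matrix.mul_apply, Fin.sum_univ_two]

theorem vMat_eq {F : Type*} [Field F] (x y z : Matrix (Fin 2) (Fin 2) F) :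
    vMat F x y z =
      !![1, 0, x 0 0, x 0 1, y 0 0, y 0 1, z 0 0, z 0 1;
         0, 1, x 1 0, x 1 1, y 1 0, y 1 1, z 1 0, z 1 1;
         0, 0, 1, 0, 0, 0, y 1 1, y 0 1;
         0, 0, 0, 1, 0, 0, y 1 0, y 0 0;
         0, 0, 0, 0, 1, 0, -x 1 1, -x 0 1;
         0, 0, 0, 0, 0, 1, -x 1 0, -x 0 0;
         0, 0, 0, 0, 0, 0, 1, 0;
         0, 0, 0, 0, 0, 0, 0, 1] := by
  ext i j
  fin_cases i <;> fin_cases j <;>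
    simp [vMat, blk8, starJ_eq]

theorem diag242_eq {F : Type*} [Field F] (m : Matrix (Fin 2) (Fin 2) F)
    (h : Matrix (Fin 4) (Fin 4) F) (d : Matrix (Fin 2) (Fin 2) F) :
    diag242 F m h d =
      !![m 0 0, m 0 1, 0, 0, 0, 0, 0, 0;
         m 1 0, m 1 1, 0, 0, 0, 0, 0, 0;
         0, 0, h 0 0, h 0 1, h 0 2, h 0 3, 0, 0;
         0, 0, h 1 0, h 1 1, h 1 2, h 1 3, 0, 0;
         0, 0, h 2 0, h 2 1, h 2 2, h 2 3, 0, 0;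
         0, 0, h 3 0, h 3 1, h 3 2, h 3 3, 0, 0;
         0, 0, 0, 0, 0, 0, d 0 0, d 0 1;
         0, 0, 0, 0, 0, 0, d 1 0, d 1 1] := by
  ext i j
  fin_cases i <;> fin_cases j <;> rfl

theorem mem_Mat20_iff {F : Type*} [Field F] (A : Matrix (Fin 2) (Fin 2) F) :
    A ∈ Mat20 F ↔ A 0 0 = A 1 1 := by
  change Aᵀ * Jmat F 2 = Jmat F 2 * A ↔ _
  rw [← Matrix.ext_iff]
  simp [Fin.forall_fin_two, Jmat_two, Matrix.mul_apply, Fin.sum_univ_two, eq_comm]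

theorem vMat_mem_Sp8 {F : Type*} [Field F] {x y z : Matrix (Fin 2) (Fin 2) F}
    (h : z - x * starJ F y ∈ Mat20 F) : vMat F x y z ∈ Sp8 F := by
  rw [mem_Mat20_iff] at h
  simp [starJ_eq, Matrix.mul_apply, Fin.sum_univ_two] at h
  rw [mem_Sp8_iff, vMat_eq]
  intro i j
  fin_cases i <;> fin_cases j <;> simp <;> grind

theorem diag242_mem_Sp8 {F : Type*} [Field F] {m d : Matrix (Fin 2) (Fin 2) F}
    {h : Matrix (Fin 4) (Fin 4) F} (hm : mᵀ * Jmat F 2 * d = Jmat F 2) (hh : h ∈ Sp4 F) :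
    diag242 F m h d ∈ Sp8 F := by
  rw [mem_Sp4_iff] at hh
  rw [← Matrix.ext_iff] at hm
  simp [Fin.forall_fin_two, Jmat_two, Matrix.mul_apply, Fin.sum_univ_two] at hm
  simp [Fin.forall_fin_succ] at hh
  rw [mem_Sp8_iff, diag242_eq]
  intro i j
  fin_cases i <;> fin_cases j <;> simp <;> grind

theorem Jmat_two_mul_self (F : Type*) [Field F] : Jmat F 2 * Jmat F 2 = 1 := by
  rw [Jmat_two]
  ext i j
  fin_cases i <;> fin_cases j <;> simp

theorem gamma1_apply (F : Type*) [Field F] (i j : Fin 8) :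
    gamma1 F i j = if j = Equiv.swap 0 7 i then (if i = 0 then -1 else 1) else 0 := by
  fin_cases i <;> fin_cases j <;> rfl

theorem gamma1_mem_Sp8 (F : Type*) [Field F] : gamma1 F ∈ Sp8 F := by
  rw [mem_Sp8_iff]
  intro i j
  fin_cases i <;> fin_cases j <;> simp [gamma1]

theorem gamma1_inv (F : Type*) [Field F] : (gamma1 F)⁻¹ = (gamma1 F)ᵀ := by
  refine Matrix.inv_eq_right_inv ?_
  ext i j
  simp only [Matrix.mul_apply, Matrix.transpose_apply, gamma1_apply, ite_mul, zero_mul,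
    Finset.sum_ite_eq', Finset.mem_univ, if_true, (Equiv.swap (0 : Fin 8) 7).injective.eq_iff,
    Matrix.one_apply]
  split_ifs <;> simp_all

theorem gamma1_conj_apply {F : Type*} [Field F] (p : Matrix (Fin 8) (Fin 8) F) (i j : Fin 8) :
    (gamma1 F * p * (gamma1 F)⁻¹) i j =
      (if i = 0 then -1 else 1) * (if j = 0 then -1 else 1) *
        p (Equiv.swap 0 7 i) (Equiv.swap 0 7 j) := by
  simp only [gamma1_inv, Matrix.mul_apply, Matrix.transpose_apply, gamma1_apply, ite_mul, mul_ite,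
    zero_mul, mul_zero, Finset.sum_ite_eq', Finset.mem_univ, if_true]
  split_ifs <;> ring

theorem gamma1_conj_mem_P8_iff {F : Type*} [Field F] {p : Matrix (Fin 8) (Fin 8) F}
    (hp : p ∈ Sp8 F) :
    gamma1 F * p * (gamma1 F)⁻¹ ∈ P8 F ↔
      ∀ i ∈ ({0, 4, 5, 6} : Finset (Fin 8)), ∀ j ∈ ({1, 2, 3, 7} : Finset (Fin 8)),
        p i j = 0 := by
  have hγ := gamma1_mem_Sp8 F
  have hmem : gamma1 F * p * (gamma1 F)⁻¹ ∈ Sp8 F :=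
    mul_mem_SpSet (n := 4) (mul_mem_SpSet (n := 4) hγ hp) (inv_mem_SpSet (n := 4) hγ)
  have hrow : ∀ i : Fin 8,
      i ∈ ({0, 4, 5, 6} : Finset (Fin 8)) ↔ 4 ≤ (Equiv.swap (0 : Fin 8) 7 i : ℕ) := by decide
  have hcol : ∀ j : Fin 8,
      j ∈ ({1, 2, 3, 7} : Finset (Fin 8)) ↔ (Equiv.swap (0 : Fin 8) 7 j : ℕ) < 4 := by decide
  have hsign : ∀ i : Fin 8, (if i = 0 then (-1 : F) else 1) ≠ 0 := by
    intro i
    split_ifs <;> simp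
  change _ ∧ _ ↔ _
  simp only [hmem, true_and, gamma1_conj_apply, mul_eq_zero, hsign, false_or, hrow, hcol]
  constructor
  · intro h i hi j hj
    simpa using h _ _ hi hj
  · intro h i j hi hj
    exact h _ (by simpa using hi) _ (by simpa using hj)

theorem mem_E2_iff {F : Type*} [Field F] (v : Fin 8 → F) :
    v ∈ E2 F ↔ ∀ i : Fin 8, 2 ≤ (i : ℕ) → v i = 0 := by
  rw [E2, Submodule.mem_span_pair]
  constructor
  · rintro ⟨a, b, rfl⟩ i hi
    have h0 : i ≠ 0 := by rintro rfl; simp at hi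
    have h1 : i ≠ 1 := by rintro rfl; simp at hi
    simp [h0, h1]
  · intro h
    refine ⟨v 0, v 1, funext fun i => ?_⟩
    by_cases hi : 2 ≤ (i : ℕ)
    · have h0 : i ≠ 0 := by rintro rfl; simp at hi
      have h1 : i ≠ 1 := by rintro rfl; simp at hi
      simp [h0, h1, h i hi]
    · have : i = 0 ∨ i = 1 := by omega
      rcases this with rfl | rfl <;> simp

theorem mem_P28_iff {F : Type*} [Field F] (p : Matrix (Fin 8) (Fin 8) F) :
    p ∈ P28 F ↔ p ∈ Sp8 F ∧ ∀ i : Fin 8, 2 ≤ (i : ℕ) → p i 0 = 0 ∧ p i 1 = 0 := by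
  refine and_congr_right fun hp => ?_
  have hle : Submodule.map p.mulVecLin (E2 F) ≤ E2 F ↔
      ∀ i : Fin 8, 2 ≤ (i : ℕ) → p i 0 = 0 ∧ p i 1 = 0 := by
    rw [Submodule.map_le_iff_le_comap]
    refine Submodule.span_le.trans ?_
    simp only [Set.insert_subset_iff, Set.singleton_subset_iff, SetLike.mem_coe,
      Submodule.mem_comap, Matrix.mulVecLin_apply, mem_E2_iff, Matrix.mulVec_single_one,
      Matrix.col_apply]
    exact ⟨fun h i hi => ⟨h.1 i hi, h.2 i hi⟩,
      fun h => ⟨fun i hi => (h i hi).1, fun i hi => (h i hi).2⟩⟩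
  rw [← hle]
  refine ⟨fun h => h.le, fun h => Submodule.eq_of_le_of_finrank_eq h ?_⟩
  exact (Submodule.equivMapOfInjective p.mulVecLin (Matrix.mulVec_injective_of_isUnit
    ((Matrix.isUnit_iff_isUnit_det _).mpr (isUnit_det_of_mem_SpSet (n := 4) hp))) _).finrank_eq.symm

theorem exists_vMat_eq {F : Type*} [Field F] {u : Matrix (Fin 8) (Fin 8) F} (hu : u ∈ Sp8 F)
    (h : ∀ i j : Fin 8, (j : ℕ) < 2 ∨ (2 ≤ (i : ℕ) ∧ (i : ℕ) < 6 ∧ (j : ℕ) < 6) →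
      u i j = if i = j then 1 else 0) :
    ∃ x y z : Matrix (Fin 2) (Fin 2) F, z - x * starJ F y ∈ Mat20 F ∧ u = vMat F x y z := by
  rw [mem_Sp8_iff] at hu
  have hcol0 : ∀ i, u i 0 = if i = 0 then 1 else 0 := fun i => h i 0 (by simp)
  have hcol1 : ∀ i, u i 1 = if i = 1 then 1 else 0 := fun i => h i 1 (by simp)
  have hrow7 : ∀ j, u 7 j = if (j : ℕ) = 7 then 1 else 0 := fun j => by
    simpa [hcol0] using hu 0 j
  have hrow6 : ∀ j, u 6 j = if 1 + (j : ℕ) = 7 then 1 else 0 := fun j => by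
    simpa [hcol1] using hu 1 j
  have hmid : ∀ i j : Fin 8, 2 ≤ (i : ℕ) ∧ (i : ℕ) < 6 ∧ (j : ℕ) < 6 →
      u i j = if i = j then 1 else 0 := fun i j hij => h i j (Or.inr hij)
  have hcol2 := fun j => hu 2 j
  have hcol3 := fun j => hu 3 j
  have hcol4 := fun j => hu 4 j
  have hcol5 := fun j => hu 5 j
  have h67 := hu 6 7
  simp [hrow6, hrow7, hmid] at hcol2 hcol3 hcol4 hcol5 h67
  have h26 := hcol2 6
  have h27 := hcol2 7
  have h36 := hcol3 6
  have h37 := hcol3 7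
  have h46 := hcol4 6
  have h47 := hcol4 7
  have h56 := hcol5 6
  have h57 := hcol5 7
  simp at h26 h27 h36 h37 h46 h47 h56 h57
  refine ⟨!![u 0 2, u 0 3; u 1 2, u 1 3], !![u 0 4, u 0 5; u 1 4, u 1 5],
    !![u 0 6, u 0 7; u 1 6, u 1 7], ?_, ?_⟩
  · rw [mem_Mat20_iff]
    simp [starJ_eq]
    grind
  · rw [vMat_eq]
    ext i j
    fin_cases i <;> fin_cases j <;> simp [hcol0, hcol1, hrow6, hrow7, hmid]
    all_goals
      clear hu h hmid hcol0 hcol1 hrow7 hrow6 hcol2 hcol3 hcol4 hcol5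
      grind

theorem isUnit_and_eq_of_transpose_mul_Jmat_mul {F : Type*} [Field F]
    {g d : Matrix (Fin 2) (Fin 2) F} (h : gᵀ * Jmat F 2 * d = Jmat F 2) :
    IsUnit g ∧ d = Jmat F 2 * (g⁻¹)ᵀ * Jmat F 2 := by
  have hJ := Jmat_two_mul_self F
  have h1 : gᵀ * (Jmat F 2 * d * Jmat F 2) = 1 := by
    rw [← mul_assoc, ← mul_assoc, h, hJ]
  have h2 : (gᵀ)⁻¹ = Jmat F 2 * d * Jmat F 2 := Matrix.inv_eq_right_inv h1
  refine ⟨(Matrix.isUnit_transpose g).mp (IsUnit.of_mul_eq_one _ h1), ?_⟩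
  rw [Matrix.transpose_nonsing_inv, h2]
  calc d = (Jmat F 2 * Jmat F 2) * d * (Jmat F 2 * Jmat F 2) := by rw [hJ, one_mul, mul_one]
    _ = _ := by simp only [mul_assoc]

theorem diag242_mulVec_mid {F : Type*} [Field F] (m d : Matrix (Fin 2) (Fin 2) F)
    (h : Matrix (Fin 4) (Fin 4) F) (w : Fin 8 → F) :
    (fun i : Fin 4 => (diag242 F m h d *ᵥ w) (Fin.natAdd 2 (Fin.castAdd 2 i))) =
      h *ᵥ fun i => w (Fin.natAdd 2 (Fin.castAdd 2 i)) := by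
  rw [diag242_eq]
  ext i
  fin_cases i <;> simp [Matrix.mulVec, dotProduct, Fin.sum_univ_eight, Fin.sum_univ_four]

theorem exists_diag242_mul_vMat {F : Type*} [Field F] {p : Matrix (Fin 8) (Fin 8) F}
    (hp : p ∈ P28 F) :
    ∃ (g₀ : Matrix (Fin 2) (Fin 2) F) (h₀ : Matrix (Fin 4) (Fin 4) F)
      (x y z : Matrix (Fin 2) (Fin 2) F),
      IsUnit g₀ ∧ h₀ ∈ Sp4 F ∧ z - x * starJ F y ∈ Mat20 F ∧
        p = diag242 F g₀ h₀ (Jmat F 2 * (g₀⁻¹)ᵀ * Jmat F 2) * vMat F x y z := by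
  obtain ⟨hp, hcol⟩ := (mem_P28_iff p).mp hp
  have hSp := (mem_Sp8_iff p).mp hp
  have hp0 : ∀ i : Fin 8, 2 ≤ (i : ℕ) → p i 0 = 0 := fun i hi => (hcol i hi).1
  have hp1 : ∀ i : Fin 8, 2 ≤ (i : ℕ) → p i 1 = 0 := fun i hi => (hcol i hi).2
  have hS0 := fun j => hSp 0 j
  have hS1 := fun j => hSp 1 j
  simp [hp0, hp1] at hS0 hS1
  set g₀ : Matrix (Fin 2) (Fin 2) F := !![p 0 0, p 0 1; p 1 0, p 1 1] with hg₀
  set d : Matrix (Fin 2) (Fin 2) F := !![p 6 6, p 6 7; p 7 6, p 7 7] with hd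
  set h₀ : Matrix (Fin 4) (Fin 4) F :=
    Matrix.of fun i j => p (Fin.natAdd 2 (Fin.castAdd 2 i)) (Fin.natAdd 2 (Fin.castAdd 2 j))
  have hgd : g₀ᵀ * Jmat F 2 * d = Jmat F 2 := by
    have h06 := hS0 6
    have h07 := hS0 7
    have h16 := hS1 6
    have h17 := hS1 7
    simp at h06 h07 h16 h17
    rw [Jmat_two]
    ext i j
    fin_cases i <;> fin_cases j <;>
      simp [hg₀, hd, Matrix.mul_apply, Fin.sum_univ_two] <;> grind
  obtain ⟨hg, hd'⟩ := isUnit_and_eq_of_transpose_mul_Jmat_mul hgd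
  have hdet : p 0 0 * p 1 1 - p 0 1 * p 1 0 ≠ 0 := by
    have := ((Matrix.isUnit_iff_isUnit_det _).mp hg).ne_zero
    rwa [hg₀, Matrix.det_fin_two_of] at this
  have hrow : ∀ j : Fin 8, (j : ℕ) < 6 → p 6 j = 0 ∧ p 7 j = 0 := by
    intro j hj
    have e0 := hS0 j
    have e1 := hS1 j
    rw [if_neg (by omega)] at e0 e1
    constructor
    · refine (mul_eq_zero.mp ?_).resolve_left hdet
      linear_combination p 0 0 * e1 - p 0 1 * e0
    · refine (mul_eq_zero.mp ?_).resolve_left hdet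
      linear_combination p 1 1 * e0 - p 1 0 * e1
  have hh : h₀ ∈ Sp4 F := by
    rw [mem_Sp4_iff]
    intro i j
    have := hSp (Fin.natAdd 2 (Fin.castAdd 2 i)) (Fin.natAdd 2 (Fin.castAdd 2 j))
    have e6 : ∀ k : Fin 4, p 6 (Fin.natAdd 2 (Fin.castAdd 2 k)) = 0 :=
      fun k => (hrow _ (by simp; omega)).1
    have e7 : ∀ k : Fin 4, p 7 (Fin.natAdd 2 (Fin.castAdd 2 k)) = 0 :=
      fun k => (hrow _ (by simp; omega)).2
    simp only [e6, e7, mul_zero, zero_mul, zero_add, sub_zero, Fin.val_natAdd,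
      Fin.val_castAdd] at this
    refine this.trans ?_
    congr 1
    · rw [eq_iff_iff]
      omega
    · congr 1
      rw [eq_iff_iff]
      omega
  have hm := diag242_mem_Sp8 hgd hh
  have hmu := isUnit_det_of_mem_SpSet (n := 4) hm
  have hmul : diag242 F g₀ h₀ d * ((diag242 F g₀ h₀ d)⁻¹ * p) = p :=
    Matrix.mul_nonsing_inv_cancel_left _ _ hmu
  have hu : (diag242 F g₀ h₀ d)⁻¹ * p ∈ Sp8 F :=
    mul_mem_SpSet (n := 4) (inv_mem_SpSet (n := 4) hm) hp
  generalize (diag242 F g₀ h₀ d)⁻¹ * p = u at hmul hu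
  have hmulVec : ∀ j, diag242 F g₀ h₀ d *ᵥ u.col j = p.col j := fun j =>
    congrArg (fun q : Matrix (Fin 8) (Fin 8) F => q.col j) hmul
  have hinj := Matrix.mulVec_injective_of_isUnit ((Matrix.isUnit_iff_isUnit_det _).mpr hmu)
  have hinj₀ := Matrix.mulVec_injective_of_isUnit
    ((Matrix.isUnit_iff_isUnit_det _).mpr (isUnit_det_of_mem_SpSet (n := 2) hh))
  have hu0 : u.col 0 = Pi.single 0 1 := hinj <| by
    rw [hmulVec, Matrix.mulVec_single_one, diag242_eq]
    ext i
    fin_cases i <;> simp [hg₀, hp0]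
  have hu1 : u.col 1 = Pi.single 1 1 := hinj <| by
    rw [hmulVec, Matrix.mulVec_single_one, diag242_eq]
    ext i
    fin_cases i <;> simp [hg₀, hp1]
  have humid : ∀ j : Fin 4, (fun i : Fin 4 => u (Fin.natAdd 2 (Fin.castAdd 2 i))
      (Fin.natAdd 2 (Fin.castAdd 2 j))) = Pi.single j 1 := fun j => hinj₀ <| by
    have := diag242_mulVec_mid g₀ d h₀ (u.col (Fin.natAdd 2 (Fin.castAdd 2 j)))
    rw [hmulVec] at this
    rw [Matrix.mulVec_single_one]
    exact this.symm
  obtain ⟨x, y, z, hz, rfl⟩ := exists_vMat_eq hu (by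
    intro i j hij
    by_cases hj : (j : ℕ) < 2
    · have : j = 0 ∨ j = 1 := by omega
      rcases this with rfl | rfl
      · simpa [Pi.single_apply] using congrFun hu0 i
      · simpa [Pi.single_apply] using congrFun hu1 i
    · obtain ⟨hi, hi', hj'⟩ := hij.resolve_left hj
      have := congrFun (humid ⟨j - 2, by omega⟩) ⟨i - 2, by omega⟩
      have ei : Fin.natAdd 2 (Fin.castAdd 2 (⟨i - 2, by omega⟩ : Fin 4)) = i :=
        Fin.ext (by simp; omega)
      have ej : Fin.natAdd 2 (Fin.castAdd 2 (⟨j - 2, by omega⟩ : Fin 4)) = j :=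
        Fin.ext (by simp; omega)
      rw [ei, ej, Pi.single_apply] at this
      rw [this]
      congr 1
      rw [eq_iff_iff, Fin.ext_iff, Fin.ext_iff]
      simp only
      omega)
  exact ⟨g₀, h₀, x, y, z, hg, hh, hz, by rw [← hd', hmul]⟩

theorem diag242_mul_vMat_mem_P28 {F : Type*} [Field F]
    {g₀ : Matrix (Fin 2) (Fin 2) F} {h₀ : Matrix (Fin 4) (Fin 4) F}
    {x y z : Matrix (Fin 2) (Fin 2) F} (hg : IsUnit g₀) (hh : h₀ ∈ Sp4 F)
    (hz : z - x * starJ F y ∈ Mat20 F) :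
    diag242 F g₀ h₀ (Jmat F 2 * (g₀⁻¹)ᵀ * Jmat F 2) * vMat F x y z ∈ P28 F := by
  rw [mem_P28_iff]
  refine ⟨mul_mem_SpSet (n := 4) (diag242_mem_Sp8 ?_ hh) (vMat_mem_Sp8 hz), ?_⟩
  · have hJ := Jmat_two_mul_self F
    have hg' : g₀ᵀ * (g₀⁻¹)ᵀ = 1 := by
      rw [← Matrix.transpose_mul,
        Matrix.nonsing_inv_mul _ ((Matrix.isUnit_iff_isUnit_det _).mp hg), Matrix.transpose_one]
    calc g₀ᵀ * Jmat F 2 * (Jmat F 2 * (g₀⁻¹)ᵀ * Jmat F 2)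
        = g₀ᵀ * (Jmat F 2 * Jmat F 2) * (g₀⁻¹)ᵀ * Jmat F 2 := by simp only [mul_assoc]
      _ = Jmat F 2 := by rw [hJ, mul_one, hg', one_mul]
  · intro i hi
    rw [diag242_eq, vMat_eq]
    fin_cases i <;> simp at hi <;> simp [Matrix.mul_apply, Fin.sum_univ_eight]

theorem gamma1_conj_diag242_mul_vMat_mem_P8_iff {F : Type*} [Field F]
    {g₀ : Matrix (Fin 2) (Fin 2) F} {h₀ : Matrix (Fin 4) (Fin 4) F}
    {x y z : Matrix (Fin 2) (Fin 2) F} (hg : IsUnit g₀) (hh : h₀ ∈ Sp4 F)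
    (hz : z - x * starJ F y ∈ Mat20 F) :
    gamma1 F * (diag242 F g₀ h₀ (Jmat F 2 * (g₀⁻¹)ᵀ * Jmat F 2) * vMat F x y z) *
        (gamma1 F)⁻¹ ∈ P8 F ↔
      g₀ 0 1 = 0 ∧ h₀ ∈ P4 F ∧ (∀ j : Fin 2, x 0 j = 0) ∧ z 0 1 = 0 := by
  have hP4 : h₀ ∈ P4 F ↔ h₀ 2 0 = 0 ∧ h₀ 2 1 = 0 ∧ h₀ 3 0 = 0 ∧ h₀ 3 1 = 0 := by
    change _ ∧ _ ↔ _
    simp [hh, Fin.forall_fin_succ]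
    tauto
  have hdet : g₀ 0 0 * g₀ 1 1 - g₀ 0 1 * g₀ 1 0 ≠ 0 := by
    rw [← Matrix.det_fin_two]
    exact ((Matrix.isUnit_iff_isUnit_det _).mp hg).ne_zero
  have hd : (Jmat F 2 * (g₀⁻¹)ᵀ * Jmat F 2) 0 1 = (g₀⁻¹) 0 1 := by
    change starJ F g₀⁻¹ 0 1 = _
    simp [starJ_eq]
  have hinv : g₀ 0 1 = 0 → (g₀⁻¹) 0 1 = 0 := by
    intro h
    simp [Matrix.inv_def, Matrix.adjugate_fin_two, h]
  rw [gamma1_conj_mem_P8_iff ((mem_P28_iff _).mp (diag242_mul_vMat_mem_P28 hg hh hz)).1, hP4]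
  generalize Jmat F 2 * (g₀⁻¹)ᵀ * Jmat F 2 = d at hd ⊢
  rw [diag242_eq, vMat_eq]
  simp only [Finset.forall_mem_insert, Finset.mem_singleton, forall_eq, Fin.forall_fin_two]
  simp [Matrix.mul_apply, Fin.sum_univ_eight]
  grind

/-- the stabilizer `{ p ∈ P_{2,8}(F) : γ₁ p γ₁⁻¹ ∈ P_8(F) }` consists of
the products `diag(g₀, h₀, J₂ ᵗg₀⁻¹ J₂) · v(x,y,z)` with `g₀ ∈ GL_2(F)` lower
triangular, `h₀ ∈ P_4(F)`, `v(x,y,z) ∈ N_{2,8}(F)` with first row of `x` zero and the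
`(1,2)` entry of `z` zero. -/
theorem statement15 (F : Type*) [Field F] :
    {p | p ∈ P28 F ∧ gamma1 F * p * (gamma1 F)⁻¹ ∈ P8 F} =
      {g | ∃ (g₀ : Matrix (Fin 2) (Fin 2) F) (h₀ : Matrix (Fin 4) (Fin 4) F)
            (x y z : Matrix (Fin 2) (Fin 2) F),
          IsUnit g₀ ∧ g₀ 0 1 = 0 ∧ h₀ ∈ P4 F ∧
          z - x * starJ F y ∈ Mat20 F ∧ (∀ j : Fin 2, x 0 j = 0) ∧ z 0 1 = 0 ∧
          g = diag242 F g₀ h₀ (Jmat F 2 * (g₀⁻¹)ᵀ * Jmat F 2) * vMat F x y z} := by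
  ext p
  constructor
  · rintro ⟨hp, hγ⟩
    obtain ⟨g₀, h₀, x, y, z, hg, hh, hz, rfl⟩ := exists_diag242_mul_vMat hp
    obtain ⟨h1, h2, h3, h4⟩ := (gamma1_conj_diag242_mul_vMat_mem_P8_iff hg hh hz).mp hγ
    exact ⟨g₀, h₀, x, y, z, hg, h1, h2, hz, h3, h4, rfl⟩
  · rintro ⟨g₀, h₀, x, y, z, hg, h1, h2, hz, h3, h4, rfl⟩
    exact ⟨diag242_mul_vMat_mem_P28 hg h2.1 hz,
      (gamma1_conj_diag242_mul_vMat_mem_P8_iff hg h2.1 hz).mpr ⟨h1, h2, h3, h4⟩⟩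

end

end GS
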